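/- arXiv:1809.04591 — 2 statements merged into one kernel-verified Lean document; each statement's English description precedes it below -/
import Mathlib

section
/- Let c be a real number with 1 < c < 3 and c ≠ 2, let ε > 0 be fixed and sufficiently small, and let P be sufficiently large with τ = P^{1-c-ε}. Then ∫_{-τ}^{τ} |S(α)|^4 dα ≪ P^{4-c}·(log P)^6, with implied constant depending only on c and ε. -/
open scoped Classical
open Finset Real MeasureTheory

/-- `eC x = e(x) = e^{2πix}`. -/
noncomputable def eC (x : ℝ) : ℂ := Complex.exp ((2 * Real.pi * x : ℝ) * Complex.I)

/-- `SS c P α = S(α) = Σ_{p ≤ P} (log p) e([p^c]α)`, the sum over primes `p ≤ P`. -/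
noncomputable def SS (c P α : ℝ) : ℂ :=
  ∑ p ∈ (Finset.range (⌊P⌋₊ + 1)).filter Nat.Prime,
    (Real.log p : ℂ) * eC ((⌊(p : ℝ) ^ c⌋ : ℝ) * α)

lemma continuous_eC_mul (x : ℝ) : Continuous fun α : ℝ => eC (x * α) := by
  unfold eC
  fun_prop

lemma norm_eC (x : ℝ) : ‖eC x‖ = 1 := by
  unfold eC
  exact Complex.norm_exp_ofReal_mul_I _

lemma eC_mul_conj (x y : ℝ) : eC x * (starRingEnd ℂ) (eC y) = eC (x - y) := by
  unfold eC
  rw [← Complex.exp_conj, ← Complex.exp_add]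
  congr 1
  simp only [map_mul, Complex.conj_ofReal, Complex.conj_I]
  push_cast
  ring

lemma norm_integral_eC_le (d τ : ℝ) (hτ : 0 ≤ τ) :
    ‖∫ α in (-τ)..τ, eC (d * α)‖ ≤ 2 * τ := by
  have h := intervalIntegral.norm_integral_le_of_norm_le_const (a := -τ) (b := τ) (C := 1)
    (f := fun α => eC (d * α)) (fun x _ => (norm_eC _).le)
  rw [abs_of_nonneg (by linarith)] at h
  linarith

lemma norm_integral_eC_le_inv (d τ : ℝ) (hd : d ≠ 0) :
    ‖∫ α in (-τ)..τ, eC (d * α)‖ ≤ 1 / |d| := by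
  have hc : (2 * Real.pi * d * Complex.I : ℂ) ≠ 0 := by
    simp [hd, Real.pi_ne_zero, Complex.I_ne_zero]
  have he : ∀ α : ℝ, eC (d * α) = Complex.exp ((2 * Real.pi * d * Complex.I : ℂ) * α) := by
    intro α
    unfold eC
    congr 1
    push_cast
    ring
  have key : ∫ α in (-τ)..τ, eC (d * α) =
      (eC (d * τ) - eC (d * (-τ))) / (2 * Real.pi * d * Complex.I : ℂ) := by
    simp_rw [he]
    rw [integral_exp_mul_complex hc]
  rw [key, norm_div]
  have h1 : ‖eC (d * τ) - eC (d * (-τ))‖ ≤ 2 := by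
    refine (norm_sub_le _ _).trans ?_
    rw [norm_eC, norm_eC]
    norm_num
  have h2 : ‖(2 * Real.pi * d * Complex.I : ℂ)‖ = 2 * Real.pi * |d| := by
    simp [abs_of_pos Real.pi_pos]
  rw [h2]
  have hd' : 0 < |d| := abs_pos.mpr hd
  rw [div_le_div_iff₀ (by positivity) hd']
  nlinarith [Real.pi_gt_three, norm_nonneg (eC (d * τ) - eC (d * (-τ)))]

/-- Expanding the square of an exponential sum and integrating term by term. -/
lemma integral_norm_sq_le (s : Finset ℕ) (a x : ℕ → ℝ) (τ : ℝ) :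
    (∫ α in (-τ)..τ, ‖∑ n ∈ s, (a n : ℂ) * eC (x n * α)‖ ^ 2) ≤
      ∑ m ∈ s, ∑ n ∈ s, |a m| * |a n| * ‖∫ α in (-τ)..τ, eC ((x m - x n) * α)‖ := by
  have hexp : ∀ α : ℝ, ((‖∑ n ∈ s, (a n : ℂ) * eC (x n * α)‖ ^ 2 : ℝ) : ℂ) =
      ∑ m ∈ s, ∑ n ∈ s, ((a m * a n : ℝ) : ℂ) * eC ((x m - x n) * α) := by
    intro α
    push_cast
    rw [← Complex.mul_conj', map_sum, Finset.sum_mul_sum]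
    refine Finset.sum_congr rfl fun m _ => Finset.sum_congr rfl fun n _ => ?_
    rw [map_mul, Complex.conj_ofReal, sub_mul, ← eC_mul_conj]
    ring
  have hint : ((∫ α in (-τ)..τ, ‖∑ n ∈ s, (a n : ℂ) * eC (x n * α)‖ ^ 2 : ℝ) : ℂ) =
      ∑ m ∈ s, ∑ n ∈ s, ((a m * a n : ℝ) : ℂ) * ∫ α in (-τ)..τ, eC ((x m - x n) * α) := by
    rw [← intervalIntegral.integral_ofReal]
    simp_rw [hexp]
    rw [intervalIntegral.integral_finsetSum]
    · refine Finset.sum_congr rfl fun m _ => ?_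
      rw [intervalIntegral.integral_finsetSum]
      · refine Finset.sum_congr rfl fun n _ => ?_
        rw [intervalIntegral.integral_const_mul]
      · intro n _
        exact ((continuous_eC_mul _).const_mul _).intervalIntegrable _ _
    · intro m _
      exact (continuous_finsetSum _ fun n _ =>
        (continuous_eC_mul _).const_mul _).intervalIntegrable _ _
  calc (∫ α in (-τ)..τ, ‖∑ n ∈ s, (a n : ℂ) * eC (x n * α)‖ ^ 2)
      ≤ ‖((∫ α in (-τ)..τ, ‖∑ n ∈ s, (a n : ℂ) * eC (x n * α)‖ ^ 2 : ℝ) : ℂ)‖ := by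
        rw [Complex.norm_real]
        exact le_abs_self _
    _ ≤ _ := by
        rw [hint]
        refine (norm_sum_le _ _).trans (Finset.sum_le_sum fun m _ => ?_)
        refine (norm_sum_le _ _).trans (Finset.sum_le_sum fun n _ => ?_)
        rw [norm_mul, Complex.norm_real, Real.norm_eq_abs, abs_mul]

lemma mul_rpow_le_rpow_sub (c y z : ℝ) (hc : 1 < c) (hy : 0 < y) (hyz : y ≤ z) :
    (z - y) * y ^ (c - 1) ≤ z ^ c - y ^ c := by
  have hz : 0 < z := hy.trans_le hyz
  have e : ∀ w : ℝ, 0 < w → w ^ c = w * w ^ (c - 1) := fun w hw => by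
    rw [Real.rpow_sub_one hw.ne']
    field_simp
  rw [e z hz, e y hy]
  have := Real.rpow_le_rpow hy.le hyz (by linarith : 0 ≤ c - 1)
  nlinarith

/-- For `m < n` in a dyadic block ending at `N`, the integers `⌊m ^ c⌋` and `⌊n ^ c⌋` are
separated enough that the kernel decays like `N ^ (1 - c) / (n - m)`. -/
lemma norm_integral_eC_floor_le (c τ : ℝ) (hc1 : 1 < c) (hc2 : c < 3) (N m n : ℕ)
    (hτ0 : 0 ≤ τ) (hτ : τ ≤ (N : ℝ) ^ (1 - c)) (hm : N < 2 * m) (hmn : m < n) (hn : n ≤ N)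
    (d : ℝ) (hd : |d| = |((⌊(n : ℝ) ^ c⌋ : ℝ) - (⌊(m : ℝ) ^ c⌋ : ℝ))|) :
    ‖∫ α in (-τ)..τ, eC (d * α)‖ ≤ 16 * (N : ℝ) ^ (1 - c) / ((n : ℝ) - m) := by
  have hNpos : 0 < (N : ℝ) := by
    have : 0 < N := by omega
    exact_mod_cast this
  have hN1 : 1 ≤ (N : ℝ) := by
    have : 1 ≤ N := by omega
    exact_mod_cast this
  have hmpos : 0 < (m : ℝ) := by
    have : 0 < m := by omega
    exact_mod_cast this
  have hmn' : (m : ℝ) < n := by exact_mod_cast hmn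
  have hNm : (N : ℝ) / 2 ≤ m := by
    have : (N : ℝ) ≤ 2 * m := by exact_mod_cast hm.le
    linarith
  set Y : ℝ := (N : ℝ) ^ (1 - c) with hY
  have hYpos : 0 < Y := Real.rpow_pos_of_pos hNpos _
  have hY1 : Y ≤ 1 := Real.rpow_le_one_of_one_le_of_nonpos hN1 (by linarith)
  have hgap : ((n : ℝ) - m) ≤ 4 * Y * ((n : ℝ) ^ c - (m : ℝ) ^ c) := by
    have h1 := mul_rpow_le_rpow_sub c m n hc1 hmpos hmn'.le
    have h2 : 1 ≤ 4 * Y * (m : ℝ) ^ (c - 1) := by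
      have h3 : ((N : ℝ) / 2) ^ (c - 1) ≤ (m : ℝ) ^ (c - 1) :=
        Real.rpow_le_rpow (by positivity) hNm (by linarith)
      rw [Real.div_rpow hNpos.le (by norm_num)] at h3
      have h4 : (2 : ℝ) ^ (c - 1) ≤ 4 := by
        calc (2 : ℝ) ^ (c - 1) ≤ 2 ^ (2 : ℝ) :=
              Real.rpow_le_rpow_of_exponent_le (by norm_num) (by linarith)
          _ = 4 := by norm_num
      have h5 : Y * (N : ℝ) ^ (c - 1) = 1 := by
        rw [hY, ← Real.rpow_add hNpos]
        simp
      have h6 : (0 : ℝ) < 2 ^ (c - 1) := by positivity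
      rw [div_le_iff₀ h6] at h3
      have h7 : 0 ≤ (m : ℝ) ^ (c - 1) := by positivity
      calc 1 = Y * (N : ℝ) ^ (c - 1) := h5.symm
        _ ≤ Y * ((m : ℝ) ^ (c - 1) * 2 ^ (c - 1)) := by gcongr
        _ ≤ Y * ((m : ℝ) ^ (c - 1) * 4) := by gcongr
        _ = _ := by ring
    calc ((n : ℝ) - m) ≤ (n - m) * (4 * Y * (m : ℝ) ^ (c - 1)) :=
          le_mul_of_one_le_right (by linarith) h2
      _ = 4 * Y * ((n - m) * (m : ℝ) ^ (c - 1)) := by ring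
      _ ≤ _ := by gcongr
  have hsub : 0 < (n : ℝ) - m := by linarith
  rw [le_div_iff₀ hsub]
  by_cases hbig : 2 ≤ (n : ℝ) ^ c - (m : ℝ) ^ c
  · have hdist : ((n : ℝ) ^ c - (m : ℝ) ^ c) / 2 ≤ |d| := by
      rw [hd]
      refine le_trans ?_ (le_abs_self _)
      linarith [Int.floor_le ((m : ℝ) ^ c), Int.lt_floor_add_one ((n : ℝ) ^ c)]
    have hdpos : 0 < |d| := by linarith
    have hle := norm_integral_eC_le_inv d τ (abs_pos.mp hdpos)
    rw [le_div_iff₀ hdpos] at hle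
    have hI := norm_nonneg (∫ α in (-τ)..τ, eC (d * α))
    have hs : (n : ℝ) - m ≤ 8 * Y * |d| := by nlinarith
    calc _ ≤ ‖∫ α in (-τ)..τ, eC (d * α)‖ * (8 * Y * |d|) := by gcongr
      _ = 8 * Y * (‖∫ α in (-τ)..τ, eC (d * α)‖ * |d|) := by ring
      _ ≤ 8 * Y * 1 := by gcongr
      _ ≤ _ := by linarith
  · push Not at hbig
    have hle := norm_integral_eC_le d τ hτ0
    have hs : (n : ℝ) - m ≤ 8 := by nlinarith
    calc _ ≤ (2 * Y) * 8 := by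
          gcongr
          linarith
      _ = _ := by ring

lemma sum_inv_one_add_dist_le (N m : ℕ) (hm0 : 0 < m) (hm : m ≤ N) (L : ℝ) (hL1 : 1 ≤ L)
    (hL : Real.log N ≤ L) :
    ∑ n ∈ Finset.Ioc (N / 2) N, 1 / (1 + |(m : ℝ) - n|) ≤ 4 * L := by
  have hharm : ∑ k ∈ Finset.range N, 1 / (1 + (k : ℝ)) ≤ 2 * L := by
    have h := harmonic_le_one_add_log N
    have e : ((harmonic N : ℚ) : ℝ) = ∑ k ∈ Finset.range N, 1 / (1 + (k : ℝ)) := by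
      unfold harmonic
      push_cast
      refine Finset.sum_congr rfl fun k _ => ?_
      rw [one_div, add_comm]
    rw [e] at h
    linarith
  have hpos : ∀ k : ℕ, 0 ≤ 1 / (1 + (k : ℝ)) := fun k => by positivity
  rw [← Finset.sum_filter_add_sum_filter_not _ (fun n => n ≤ m)]
  have h1 : ∑ n ∈ (Finset.Ioc (N / 2) N).filter (fun n => n ≤ m), 1 / (1 + |(m : ℝ) - n|) ≤
      ∑ k ∈ Finset.range N, 1 / (1 + (k : ℝ)) := by
    rw [Finset.sum_congr rfl (g := fun n => (fun k : ℕ => 1 / (1 + (k : ℝ))) (m - n))]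
    · rw [← Finset.sum_image (f := fun k : ℕ => 1 / (1 + (k : ℝ)))]
      · refine Finset.sum_le_sum_of_subset_of_nonneg ?_ fun k _ _ => hpos k
        intro k hk
        simp only [Finset.mem_image, Finset.mem_filter, Finset.mem_Ioc, Finset.mem_range] at hk ⊢
        obtain ⟨n, hn, rfl⟩ := hk
        omega
      · intro n hn n' hn' h
        simp only [Finset.coe_filter, Finset.mem_Ioc, Set.mem_ofPred_eq] at hn hn'
        omega
    · intro n hn
      simp only [Finset.mem_filter] at hn
      have : (n : ℝ) ≤ m := by exact_mod_cast hn.2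
      rw [abs_of_nonneg (by linarith)]
      simp only
      rw [Nat.cast_sub hn.2]
  have h2 : ∑ n ∈ (Finset.Ioc (N / 2) N).filter (fun n => ¬ n ≤ m), 1 / (1 + |(m : ℝ) - n|) ≤
      ∑ k ∈ Finset.range N, 1 / (1 + (k : ℝ)) := by
    rw [Finset.sum_congr rfl (g := fun n => (fun k : ℕ => 1 / (1 + (k : ℝ))) (n - m))]
    · rw [← Finset.sum_image (f := fun k : ℕ => 1 / (1 + (k : ℝ)))]
      · refine Finset.sum_le_sum_of_subset_of_nonneg ?_ fun k _ _ => hpos k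
        intro k hk
        simp only [Finset.mem_image, Finset.mem_filter, Finset.mem_Ioc,
          Finset.mem_range] at hk ⊢
        obtain ⟨n, hn, rfl⟩ := hk
        omega
      · intro n hn n' hn' h
        simp only [Finset.coe_filter, Finset.mem_Ioc, Set.mem_ofPred_eq] at hn hn'
        simp only at h
        omega
    · intro n hn
      simp only [Finset.mem_filter, not_le] at hn
      have : (m : ℝ) < n := by exact_mod_cast hn.2
      rw [abs_of_neg (by linarith)]
      simp only
      rw [Nat.cast_sub hn.2.le, neg_sub]
  linarith

lemma integral_dyadic_norm_sq_le (c τ L : ℝ) (hc1 : 1 < c) (hc2 : c < 3) (N : ℕ) (a : ℕ → ℝ)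
    (hN : 1 ≤ N) (hτ0 : 0 ≤ τ) (hτ : τ ≤ (N : ℝ) ^ (1 - c)) (hL1 : 1 ≤ L)
    (hL : Real.log N ≤ L) (ha : ∀ n ≤ N, |a n| ≤ L) :
    (∫ α in (-τ)..τ,
      ‖∑ n ∈ Finset.Ioc (N / 2) N, (a n : ℂ) * eC ((⌊(n : ℝ) ^ c⌋ : ℝ) * α)‖ ^ 2) ≤
      128 * L ^ 3 * (N : ℝ) ^ (2 - c) := by
  have hNpos : 0 < (N : ℝ) := by exact_mod_cast hN
  set Y : ℝ := (N : ℝ) ^ (1 - c) with hY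
  have hYpos : 0 < Y := Real.rpow_pos_of_pos hNpos _
  have hker : ∀ m ∈ Finset.Ioc (N / 2) N, ∀ n ∈ Finset.Ioc (N / 2) N,
      ‖∫ α in (-τ)..τ, eC (((⌊(m : ℝ) ^ c⌋ : ℝ) - (⌊(n : ℝ) ^ c⌋ : ℝ)) * α)‖ ≤
        32 * Y * (1 / (1 + |(m : ℝ) - n|)) := by
    intro m hm n hn
    rw [Finset.mem_Ioc] at hm hn
    have hpass : ∀ t : ℝ, 1 ≤ t → 16 * Y / t ≤ 32 * Y * (1 / (1 + t)) := by
      intro t ht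
      rw [mul_one_div, div_le_div_iff₀ (by linarith) (by linarith)]
      nlinarith
    rcases lt_trichotomy m n with h | h | h
    · have h1 := norm_integral_eC_floor_le c τ hc1 hc2 N m n hτ0 hτ (by omega) h hn.2 _
        (abs_sub_comm (⌊(m : ℝ) ^ c⌋ : ℝ) (⌊(n : ℝ) ^ c⌋ : ℝ))
      have h2 : (m : ℝ) + 1 ≤ n := by exact_mod_cast h
      rw [abs_of_neg (by linarith), neg_sub]
      exact h1.trans (hpass _ (by linarith))
    · subst h
      have h1 := norm_integral_eC_le ((⌊(m : ℝ) ^ c⌋ : ℝ) - (⌊(m : ℝ) ^ c⌋ : ℝ)) τ hτ0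
      refine h1.trans ?_
      rw [sub_self (m : ℝ), abs_zero]
      linarith
    · have h1 := norm_integral_eC_floor_le c τ hc1 hc2 N n m hτ0 hτ (by omega) h hm.2 _
        (rfl : |((⌊(m : ℝ) ^ c⌋ : ℝ) - (⌊(n : ℝ) ^ c⌋ : ℝ))| = _)
      have h2 : (n : ℝ) + 1 ≤ m := by exact_mod_cast h
      rw [abs_of_pos (by linarith : 0 < (m : ℝ) - n)]
      exact h1.trans (hpass _ (by linarith))
  refine (integral_norm_sq_le _ a (fun n => (⌊(n : ℝ) ^ c⌋ : ℝ)) τ).trans ?_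
  have hrow : ∀ m ∈ Finset.Ioc (N / 2) N, ∑ n ∈ Finset.Ioc (N / 2) N, |a m| * |a n| *
      ‖∫ α in (-τ)..τ, eC (((⌊(m : ℝ) ^ c⌋ : ℝ) - (⌊(n : ℝ) ^ c⌋ : ℝ)) * α)‖ ≤
      128 * L ^ 3 * Y := by
    intro m hm
    have hm' := Finset.mem_Ioc.mp hm
    calc _ ≤ ∑ n ∈ Finset.Ioc (N / 2) N, L * L * (32 * Y * (1 / (1 + |(m : ℝ) - n|))) := by
          refine Finset.sum_le_sum fun n hn => ?_
          have hn' := Finset.mem_Ioc.mp hn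
          have h1 := ha m hm'.2
          have h2 := ha n hn'.2
          have h3 := hker m hm n hn
          gcongr
      _ = L * L * (32 * Y) * ∑ n ∈ Finset.Ioc (N / 2) N, 1 / (1 + |(m : ℝ) - n|) := by
          rw [Finset.mul_sum]
          exact Finset.sum_congr rfl fun n _ => by ring
      _ ≤ L * L * (32 * Y) * (4 * L) := by
          gcongr
          exact sum_inv_one_add_dist_le N m (by omega) hm'.2 L hL1 hL
      _ = _ := by ring
  refine (Finset.sum_le_card_nsmul _ _ _ hrow).trans ?_
  have hcard : ((Finset.Ioc (N / 2) N).card : ℝ) ≤ N := by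
    rw [Nat.card_Ioc]
    exact_mod_cast Nat.sub_le _ _
  have hYN : (N : ℝ) ^ (2 - c) = N * Y := by
    rw [hY, show 2 - c = 1 + (1 - c) by ring, Real.rpow_add hNpos, Real.rpow_one]
  rw [nsmul_eq_mul, hYN]
  calc _ ≤ (N : ℝ) * (128 * L ^ 3 * Y) := by gcongr
    _ = _ := by ring

lemma integral_dyadic_norm_pow_four_le (c τ L : ℝ) (hc1 : 1 < c) (hc2 : c < 3) (N : ℕ)
    (a : ℕ → ℝ) (hN : 1 ≤ N) (hτ0 : 0 ≤ τ) (hτ : τ ≤ (N : ℝ) ^ (1 - c)) (hL1 : 1 ≤ L)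
    (hL : Real.log N ≤ L) (ha : ∀ n ≤ N, |a n| ≤ L) :
    (∫ α in (-τ)..τ,
      ‖∑ n ∈ Finset.Ioc (N / 2) N, (a n : ℂ) * eC ((⌊(n : ℝ) ^ c⌋ : ℝ) * α)‖ ^ 4) ≤
      128 * L ^ 5 * (N : ℝ) ^ (4 - c) := by
  have hNpos : 0 < (N : ℝ) := by exact_mod_cast hN
  have hcont : Continuous fun α : ℝ =>
      ∑ n ∈ Finset.Ioc (N / 2) N, (a n : ℂ) * eC ((⌊(n : ℝ) ^ c⌋ : ℝ) * α) :=
    continuous_finsetSum _ fun n _ => (continuous_eC_mul _).const_mul _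
  have hsup : ∀ α : ℝ,
      ‖∑ n ∈ Finset.Ioc (N / 2) N, (a n : ℂ) * eC ((⌊(n : ℝ) ^ c⌋ : ℝ) * α)‖ ≤ N * L := by
    intro α
    refine (norm_sum_le_of_le (f := fun n => (a n : ℂ) * eC ((⌊(n : ℝ) ^ c⌋ : ℝ) * α))
      (n := fun _ => L) _ fun n hn => ?_).trans ?_
    · rw [norm_mul, norm_eC, mul_one, Complex.norm_real]
      exact ha n (Finset.mem_Ioc.mp hn).2
    · rw [Finset.sum_const, nsmul_eq_mul, Nat.card_Ioc]
      gcongr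
      exact Nat.sub_le _ _
  have h2 := integral_dyadic_norm_sq_le c τ L hc1 hc2 N a hN hτ0 hτ hL1 hL ha
  have hNN : (N : ℝ) ^ (4 - c) = (N : ℝ) ^ 2 * (N : ℝ) ^ (2 - c) := by
    rw [show 4 - c = ((2 : ℕ) : ℝ) + (2 - c) by push_cast; ring, Real.rpow_add hNpos,
      Real.rpow_natCast]
  calc _ ≤ ∫ α in (-τ)..τ, (N * L) ^ 2 *
        ‖∑ n ∈ Finset.Ioc (N / 2) N, (a n : ℂ) * eC ((⌊(n : ℝ) ^ c⌋ : ℝ) * α)‖ ^ 2 := by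
        refine intervalIntegral.integral_mono_on (by linarith)
          ((hcont.norm.pow 4).intervalIntegrable _ _)
          (((hcont.norm.pow 2).const_mul _).intervalIntegrable _ _) fun α _ => ?_
        rw [show 4 = 2 + 2 from rfl, pow_add]
        gcongr
        exact hsup α
    _ = (N * L) ^ 2 * ∫ α in (-τ)..τ,
        ‖∑ n ∈ Finset.Ioc (N / 2) N, (a n : ℂ) * eC ((⌊(n : ℝ) ^ c⌋ : ℝ) * α)‖ ^ 2 :=
        intervalIntegral.integral_const_mul _ _
    _ ≤ (N * L) ^ 2 * (128 * L ^ 3 * (N : ℝ) ^ (2 - c)) := by gcongr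
    _ = _ := by
        rw [hNN]
        ring

lemma add_pow_four_le (x y : ℝ) (hx : 0 ≤ x) (hy : 0 ≤ y) :
    (x + y) ^ 4 ≤ 1.331 * x ^ 4 + 1331 * y ^ 4 := by
  have h : 1.331 * x ^ 4 + 1331 * y ^ 4 - (x + y) ^ 4 =
      (x - 10 * y) ^ 2 * (0.331 * x ^ 2 + 2.62 * (x * y) + 13.3 * y ^ 2) := by
    ring
  have : 0 ≤ (x - 10 * y) ^ 2 * (0.331 * x ^ 2 + 2.62 * (x * y) + 13.3 * y ^ 2) := by
    positivity
  linarith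

/-- The dyadic pieces are summed by strong induction on `N`, splitting at `N / 2`. -/
lemma integral_norm_pow_four_le (c τ L P : ℝ) (hc1 : 1 < c) (hc2 : c < 3) (a : ℕ → ℝ)
    (hτ0 : 0 ≤ τ) (hτ : τ ≤ P ^ (1 - c)) (hL1 : 1 ≤ L)
    (hL : Real.log P ≤ L) (N : ℕ) (hNP : (N : ℝ) ≤ P) (ha : ∀ n ≤ N, |a n| ≤ L) :
    (∫ α in (-τ)..τ,
      ‖∑ n ∈ Finset.Ioc 0 N, (a n : ℂ) * eC ((⌊(n : ℝ) ^ c⌋ : ℝ) * α)‖ ^ 4) ≤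
      1000000 * L ^ 5 * (N : ℝ) ^ (4 - c) := by
  induction N using Nat.strong_induction_on with
  | _ N ih =>
  rcases Nat.eq_zero_or_pos N with rfl | hN
  · simp only [Finset.Ioc_self, Finset.sum_empty, norm_zero]
    rw [zero_pow (by norm_num), intervalIntegral.integral_zero]
    positivity
  have hNpos : 0 < (N : ℝ) := by exact_mod_cast hN
  have hhalf : ((N / 2 : ℕ) : ℝ) ≤ N / 2 := Nat.cast_div_le
  have hI := ih (N / 2) (by omega) (by linarith) fun n hn => ha n (by omega)
  have hJ := integral_dyadic_norm_pow_four_le c τ L hc1 hc2 N a hN hτ0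
    (hτ.trans (Real.rpow_le_rpow_of_nonpos hNpos hNP (by linarith))) hL1
    ((Real.log_le_log hNpos hNP).trans hL) ha
  have hcont : ∀ s : Finset ℕ, Continuous fun α : ℝ =>
      ∑ n ∈ s, (a n : ℂ) * eC ((⌊(n : ℝ) ^ c⌋ : ℝ) * α) := fun s =>
    continuous_finsetSum _ fun n _ => (continuous_eC_mul _).const_mul _
  have hint : ∀ (s : Finset ℕ) (r : ℝ), IntervalIntegrable (fun α : ℝ =>
      r * ‖∑ n ∈ s, (a n : ℂ) * eC ((⌊(n : ℝ) ^ c⌋ : ℝ) * α)‖ ^ 4) volume (-τ) τ := fun s _ =>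
    (((hcont s).norm.pow 4).const_mul _).intervalIntegrable _ _
  have hpow : ((N / 2 : ℕ) : ℝ) ^ (4 - c) ≤ (N : ℝ) ^ (4 - c) / 2 := by
    calc ((N / 2 : ℕ) : ℝ) ^ (4 - c) ≤ ((N : ℝ) / 2) ^ (4 - c) :=
          Real.rpow_le_rpow (by positivity) hhalf (by linarith)
      _ = (N : ℝ) ^ (4 - c) / 2 ^ (4 - c) := Real.div_rpow hNpos.le (by norm_num) _
      _ ≤ (N : ℝ) ^ (4 - c) / 2 := by
          gcongr
          exact Real.self_le_rpow_of_one_le (by norm_num) (by linarith)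
  have hX : 0 ≤ L ^ 5 * (N : ℝ) ^ (4 - c) := by positivity
  have hI' : 1000000 * L ^ 5 * ((N / 2 : ℕ) : ℝ) ^ (4 - c) ≤
      500000 * (L ^ 5 * (N : ℝ) ^ (4 - c)) := by
    calc _ ≤ 1000000 * L ^ 5 * ((N : ℝ) ^ (4 - c) / 2) := by gcongr
      _ = _ := by ring
  calc _ ≤ ∫ α in (-τ)..τ, (1.331 *
        ‖∑ n ∈ Finset.Ioc 0 (N / 2), (a n : ℂ) * eC ((⌊(n : ℝ) ^ c⌋ : ℝ) * α)‖ ^ 4 + 1331 *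
        ‖∑ n ∈ Finset.Ioc (N / 2) N, (a n : ℂ) * eC ((⌊(n : ℝ) ^ c⌋ : ℝ) * α)‖ ^ 4) := by
        refine intervalIntegral.integral_mono_on (by linarith)
          (((hcont _).norm.pow 4).intervalIntegrable _ _)
          ((hint _ _).add (hint _ _)) fun α _ => ?_
        rw [← Finset.sum_Ioc_consecutive _ (Nat.zero_le (N / 2)) (Nat.div_le_self N 2)]
        exact (pow_le_pow_left₀ (norm_nonneg _) (norm_add_le _ _) 4).trans
          (add_pow_four_le _ _ (norm_nonneg _) (norm_nonneg _))
    _ = 1.331 * (∫ α in (-τ)..τ,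
        ‖∑ n ∈ Finset.Ioc 0 (N / 2), (a n : ℂ) * eC ((⌊(n : ℝ) ^ c⌋ : ℝ) * α)‖ ^ 4) + 1331 *
        ∫ α in (-τ)..τ,
        ‖∑ n ∈ Finset.Ioc (N / 2) N, (a n : ℂ) * eC ((⌊(n : ℝ) ^ c⌋ : ℝ) * α)‖ ^ 4 := by
        rw [intervalIntegral.integral_add (hint _ _) (hint _ _),
          intervalIntegral.integral_const_mul, intervalIntegral.integral_const_mul]
    _ ≤ _ := by linarith

theorem stmt_5 (c : ℝ) (hc1 : 1 < c) (hc2 : c < 3) (hc3 : c ≠ 2) :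
    ∃ ε₀ > 0, ∀ ε : ℝ, 0 < ε → ε ≤ ε₀ →
      ∃ C > 0, ∃ P₀ : ℝ, ∀ P : ℝ, P₀ ≤ P →
        ∀ τ : ℝ, τ = P ^ (1 - c - ε) →
          (∫ α in (-τ)..τ, ‖SS c P α‖ ^ 4) ≤ C * P ^ (4 - c) * Real.log P ^ 6 := by
  refine ⟨1, one_pos, fun ε hε _ => ⟨1000000, by norm_num, Real.exp 1, fun P hP τ hτ => ?_⟩⟩
  have hPpos : 0 < P := (Real.exp_pos 1).trans_le hP
  have hP1 : 1 ≤ P := (Real.one_le_exp zero_le_one).trans hP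
  have hlog : 1 ≤ Real.log P := (Real.le_log_iff_exp_le hPpos).mpr hP
  have hfl : (⌊P⌋₊ : ℝ) ≤ P := Nat.floor_le hPpos.le
  have hSS : ∀ α : ℝ, SS c P α = ∑ n ∈ Finset.Ioc 0 ⌊P⌋₊,
      ((if n.Prime then Real.log n else 0 : ℝ) : ℂ) * eC ((⌊(n : ℝ) ^ c⌋ : ℝ) * α) := by
    intro α
    unfold SS
    rw [Finset.sum_filter]
    symm
    refine Finset.sum_subset_zero_on_sdiff ?_ ?_ ?_
    · intro n hn
      rw [Finset.mem_Ioc] at hn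
      exact Finset.mem_range.mpr (by omega)
    · intro n hn
      simp only [Finset.mem_sdiff, Finset.mem_range, Finset.mem_Ioc] at hn
      have : n = 0 := by omega
      subst this
      simp
    · intro n _
      by_cases hp : n.Prime <;> simp [hp]
  have h := integral_norm_pow_four_le c τ (Real.log P) P hc1 hc2
    (fun n => if n.Prime then Real.log n else 0) (hτ ▸ by positivity)
    (hτ ▸ Real.rpow_le_rpow_of_exponent_le hP1 (by linarith)) hlog le_rfl ⌊P⌋₊ hfl ?_
  · simp_rw [hSS]
    refine h.trans ?_
    calc 1000000 * Real.log P ^ 5 * (⌊P⌋₊ : ℝ) ^ (4 - c)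
        ≤ 1000000 * Real.log P ^ 6 * P ^ (4 - c) := by
          gcongr
          · norm_num
          · linarith
      _ = _ := by ring
  · intro n hn
    have hn' : (n : ℝ) ≤ P := (Nat.cast_le.mpr hn).trans hfl
    split_ifs with hp
    · have h1 : (1 : ℝ) ≤ n := by exact_mod_cast hp.one_lt.le
      rw [abs_of_nonneg (Real.log_nonneg h1)]
      exact Real.log_le_log (by linarith) hn'
    · rw [abs_zero]
      linarith
end

section
/- For every real H ≥ 1 there exist complex numbers (a_h)_{h ∈ ℤ} such that for every real number θ one has min(1, 1/(H·‖θ‖)) = Σ_{h = -∞}^{+∞} a_h·e(hθ), and such that a_h ≪ min(log(2H)/H, 1/|h|, H/h²) for all h ≠ 0 and a_0 ≪ log(2H)/H, with absolute implied constants. -/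
open scoped Classical
open Finset Real

/-- `mfun H θ = min(1, 1/(H‖θ‖))`, where `‖θ‖ = |θ - round θ|` is the distance from `θ`
to the nearest integer, with the convention that the value is `1` when `‖θ‖ = 0`. -/
noncomputable def mfun (H θ : ℝ) : ℝ :=
  if |θ - round θ| = 0 then 1 else min 1 (1 / (H * |θ - round θ|))

/-- Integration by parts against an antitone nonnegative weight `u`. -/
theorem abs_integral_mul_deriv_le {u u' v v' : ℝ → ℝ} {a b M : ℝ} (hab : a ≤ b)
    (hu : ∀ x ∈ Set.uIcc a b, HasDerivAt u (u' x) x)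
    (hv : ∀ x ∈ Set.uIcc a b, HasDerivAt v (v' x) x)
    (hu' : ContinuousOn u' (Set.uIcc a b)) (hv' : ContinuousOn v' (Set.uIcc a b))
    (hneg : ∀ x ∈ Set.uIcc a b, u' x ≤ 0) (hub : 0 ≤ u b) (hua : 0 ≤ u a)
    (hM : ∀ x, |v x| ≤ M) :
    |∫ x in a..b, u x * v' x| ≤ 2 * M * u a := by
  have hint := hu'.intervalIntegrable (μ := MeasureTheory.volume)
  rw [intervalIntegral.integral_mul_deriv_eq_deriv_mul hu hv hint hv'.intervalIntegrable]
  have hrem : |∫ x in a..b, u' x * v x| ≤ M * (u a - u b) := by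
    have hbound : ‖∫ x in a..b, u' x * v x‖ ≤ ∫ x in a..b, -(M * u' x) := by
      apply intervalIntegral.norm_integral_le_of_norm_le hab
      · refine Filter.Eventually.of_forall fun x hx => ?_
        have hx' : u' x ≤ 0 := hneg x (by
          rw [Set.uIcc_of_le hab]; exact Set.Ioc_subset_Icc_self hx)
        rw [Real.norm_eq_abs, abs_mul, abs_of_nonpos hx']
        nlinarith [hM x]
      · exact (hint.const_mul M).neg
    rw [Real.norm_eq_abs, intervalIntegral.integral_neg, intervalIntegral.integral_const_mul,
      intervalIntegral.integral_eq_sub_of_hasDerivAt hu hint] at hbound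
    linarith
  have hb : |u b * v b| ≤ u b * M := by
    rw [abs_mul, abs_of_nonneg hub]; exact mul_le_mul_of_nonneg_left (hM b) hub
  have ha : |u a * v a| ≤ u a * M := by
    rw [abs_mul, abs_of_nonneg hua]; exact mul_le_mul_of_nonneg_left (hM a) hua
  rw [abs_le] at *
  constructor <;> linarith [hb.1, hb.2, ha.1, ha.2, hrem.1, hrem.2]

theorem abs_sin_mul_div_le (w x : ℝ) : |Real.sin (w * x) / w| ≤ 1 / |w| := by
  rw [abs_div]
  exact div_le_div_of_nonneg_right (Real.abs_sin_le_one _) (abs_nonneg w)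

theorem abs_neg_cos_mul_div_le (w x : ℝ) : |-Real.cos (w * x) / w| ≤ 1 / |w| := by
  rw [abs_div, abs_neg]
  exact div_le_div_of_nonneg_right (Real.abs_cos_le_one _) (abs_nonneg w)

theorem hasDerivAt_sin_mul_div {w : ℝ} (hw : w ≠ 0) (x : ℝ) :
    HasDerivAt (fun x => Real.sin (w * x) / w) (Real.cos (w * x)) x := by
  have h := (((hasDerivAt_id x).const_mul w).sin).div_const w
  convert! h using 1
  simp [hw]

theorem hasDerivAt_neg_cos_mul_div {w : ℝ} (hw : w ≠ 0) (x : ℝ) :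
    HasDerivAt (fun x => -Real.cos (w * x) / w) (Real.sin (w * x)) x := by
  have h := (((hasDerivAt_id x).const_mul w).cos.neg).div_const w
  convert! h using 1
  simp [hw]

theorem hasDerivAt_inv_const_mul {H x : ℝ} (hH : H ≠ 0) (hx : x ≠ 0) :
    HasDerivAt (fun x => (H * x)⁻¹) (-(H * x ^ 2)⁻¹) x := by
  have h := ((hasDerivAt_id x).const_mul H).inv (by simp [hH, hx])
  convert! h using 1
  simp only [id]
  field_simp

theorem hasDerivAt_inv_const_mul_sq {H x : ℝ} (hH : H ≠ 0) (hx : x ≠ 0) :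
    HasDerivAt (fun x => (H * x ^ 2)⁻¹) (-(2 * (H * x ^ 3)⁻¹)) x := by
  have h := (((hasDerivAt_id x).pow 2).const_mul H).inv (by simp [hH, hx])
  convert! h using 1
  simp only [id, Pi.pow_apply]
  field_simp
  norm_num

section Tail

variable {H : ℝ}

theorem pos_of_mem_uIcc_inv_half (hH : 2 ≤ H) {x : ℝ} (hx : x ∈ Set.uIcc H⁻¹ (1 / 2)) : 0 < x := by
  have hH0 : 0 < H⁻¹ := inv_pos.2 (by linarith)
  exact lt_of_lt_of_le (lt_min hH0 (by norm_num)) hx.1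

theorem inv_le_half (hH : 2 ≤ H) : H⁻¹ ≤ 1 / 2 := by
  rw [one_div]; exact inv_anti₀ (by norm_num) hH

theorem abs_integral_inv_mul_cos_le (hH : 2 ≤ H) {w : ℝ} (hw : w ≠ 0) :
    |∫ x in H⁻¹..(1 / 2), (H * x)⁻¹ * Real.cos (w * x)| ≤ 2 / |w| := by
  have hH0 : 0 < H := by linarith
  have h := abs_integral_mul_deriv_le (u := fun x => (H * x)⁻¹) (inv_le_half hH)
    (fun x hx => hasDerivAt_inv_const_mul hH0.ne' (pos_of_mem_uIcc_inv_half hH hx).ne')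
    (fun x _ => hasDerivAt_sin_mul_div hw x)
    (ContinuousOn.neg (ContinuousOn.inv₀ (by fun_prop) fun x hx => by
      have := pos_of_mem_uIcc_inv_half hH hx; positivity)) (by fun_prop)
    (fun x hx => by
      have := pos_of_mem_uIcc_inv_half hH hx
      rw [neg_nonpos]; positivity)
    (by positivity) (by positivity) (abs_sin_mul_div_le w)
  rw [mul_inv_cancel₀ hH0.ne'] at h
  simpa [div_eq_mul_inv] using h

theorem abs_integral_inv_sq_mul_sin_le (hH : 2 ≤ H) {w : ℝ} (hw : w ≠ 0) :
    |∫ x in H⁻¹..(1 / 2), (H * x ^ 2)⁻¹ * Real.sin (w * x)| ≤ 2 * H / |w| := by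
  have hH0 : 0 < H := by linarith
  have h := abs_integral_mul_deriv_le (u := fun x => (H * x ^ 2)⁻¹) (inv_le_half hH)
    (fun x hx => hasDerivAt_inv_const_mul_sq hH0.ne' (pos_of_mem_uIcc_inv_half hH hx).ne')
    (fun x _ => hasDerivAt_neg_cos_mul_div hw x)
    (ContinuousOn.neg (ContinuousOn.mul (by fun_prop)
      (ContinuousOn.inv₀ (by fun_prop) fun x hx => by
        have := pos_of_mem_uIcc_inv_half hH hx; positivity))) (by fun_prop)
    (fun x hx => by
      have := pos_of_mem_uIcc_inv_half hH hx
      rw [neg_nonpos]; positivity)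
    (by positivity) (by positivity) (abs_neg_cos_mul_div_le w)
  have e : 2 * (1 / |w|) * (H * H⁻¹ ^ 2)⁻¹ = 2 * H / |w| := by
    field_simp
  rwa [e] at h

theorem integral_inv_mul_cos_eq (hH : 2 ≤ H) {w : ℝ} (hw : w ≠ 0)
    (hsin : Real.sin (w * (1 / 2)) = 0) :
    ∫ x in H⁻¹..(1 / 2), (H * x)⁻¹ * Real.cos (w * x) =
      -(Real.sin (w * H⁻¹) / w) +
        (∫ x in H⁻¹..(1 / 2), (H * x ^ 2)⁻¹ * Real.sin (w * x)) / w := by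
  have hH0 : 0 < H := by linarith
  rw [intervalIntegral.integral_mul_deriv_eq_deriv_mul
    (fun x hx => hasDerivAt_inv_const_mul hH0.ne' (pos_of_mem_uIcc_inv_half hH hx).ne')
    (fun x _ => hasDerivAt_sin_mul_div hw x)
    (ContinuousOn.intervalIntegrable (ContinuousOn.neg (ContinuousOn.inv₀ (by fun_prop)
      fun x hx => by have := pos_of_mem_uIcc_inv_half hH hx; positivity)))
    (Continuous.intervalIntegrable (by fun_prop) _ _), hsin, mul_inv_cancel₀ hH0.ne',
    ← intervalIntegral.integral_div]
  have e : ∀ x : ℝ, -(H * x ^ 2)⁻¹ * (Real.sin (w * x) / w) =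
      -((H * x ^ 2)⁻¹ * Real.sin (w * x) / w) := fun x => by ring
  simp only [e, intervalIntegral.integral_neg]
  ring

theorem max_one_eq_one (hH : 2 ≤ H) {x : ℝ} (hx : x ∈ Set.uIcc 0 H⁻¹) : max 1 (H * x) = 1 := by
  have hH0 : 0 < H := by linarith
  rw [Set.uIcc_of_le (by positivity)] at hx
  apply max_eq_left
  calc H * x ≤ H * H⁻¹ := mul_le_mul_of_nonneg_left hx.2 hH0.le
    _ = 1 := mul_inv_cancel₀ hH0.ne'

theorem max_one_eq_mul (hH : 2 ≤ H) {x : ℝ} (hx : x ∈ Set.uIcc H⁻¹ (1 / 2)) :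
    max 1 (H * x) = H * x := by
  have hH0 : 0 < H := by linarith
  rw [Set.uIcc_of_le (inv_le_half hH)] at hx
  apply max_eq_right
  calc (1 : ℝ) = H * H⁻¹ := (mul_inv_cancel₀ hH0.ne').symm
    _ ≤ H * x := mul_le_mul_of_nonneg_left hx.1 hH0.le

theorem continuous_inv_max_one (H : ℝ) : Continuous fun x : ℝ => (max 1 (H * x))⁻¹ :=
  Continuous.inv₀ (by fun_prop) fun _ => (lt_of_lt_of_le one_pos (le_max_left _ _)).ne'

theorem integral_inv_max_one_mul_cos_eq (hH : 2 ≤ H) (w : ℝ) :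
    ∫ x in (0 : ℝ)..(1 / 2), (max 1 (H * x))⁻¹ * Real.cos (w * x) =
      (∫ x in (0 : ℝ)..H⁻¹, Real.cos (w * x)) +
        ∫ x in H⁻¹..(1 / 2), (H * x)⁻¹ * Real.cos (w * x) := by
  have hc : Continuous fun x : ℝ => (max 1 (H * x))⁻¹ * Real.cos (w * x) :=
    (continuous_inv_max_one H).mul (by fun_prop)
  rw [← intervalIntegral.integral_add_adjacent_intervals (hc.intervalIntegrable 0 H⁻¹)
    (hc.intervalIntegrable H⁻¹ (1 / 2))]
  congr 1
  · exact intervalIntegral.integral_congr fun x hx => by simp [max_one_eq_one hH hx]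
  · exact intervalIntegral.integral_congr fun x hx => by simp only [max_one_eq_mul hH hx]

theorem integral_cos_mul_eq {w : ℝ} (hw : w ≠ 0) (c : ℝ) :
    ∫ x in (0 : ℝ)..c, Real.cos (w * x) = Real.sin (w * c) / w := by
  rw [intervalIntegral.integral_eq_sub_of_hasDerivAt (fun x _ => hasDerivAt_sin_mul_div hw x)
    (Continuous.intervalIntegrable (by fun_prop) _ _)]
  simp

theorem abs_integral_inv_max_one_mul_cos_le (hH : 2 ≤ H) {w : ℝ} (hw : w ≠ 0) :
    |∫ x in (0 : ℝ)..(1 / 2), (max 1 (H * x))⁻¹ * Real.cos (w * x)| ≤ 3 / |w| := by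
  rw [integral_inv_max_one_mul_cos_eq hH, integral_cos_mul_eq hw]
  have h1 := abs_sin_mul_div_le w H⁻¹
  have h2 := abs_integral_inv_mul_cos_le hH hw
  calc _ ≤ 1 / |w| + 2 / |w| := (abs_add_le _ _).trans (add_le_add h1 h2)
    _ = 3 / |w| := by ring

theorem abs_integral_inv_max_one_mul_cos_le_sq (hH : 2 ≤ H) {w : ℝ} (hw : w ≠ 0)
    (hsin : Real.sin (w * (1 / 2)) = 0) :
    |∫ x in (0 : ℝ)..(1 / 2), (max 1 (H * x))⁻¹ * Real.cos (w * x)| ≤ 2 * H / w ^ 2 := by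
  rw [integral_inv_max_one_mul_cos_eq hH, integral_cos_mul_eq hw,
    integral_inv_mul_cos_eq hH hw hsin, add_neg_cancel_left, abs_div, ← sq_abs w]
  calc _ ≤ 2 * H / |w| / |w| :=
        div_le_div_of_nonneg_right (abs_integral_inv_sq_mul_sin_le hH hw) (abs_nonneg w)
    _ = 2 * H / |w| ^ 2 := by rw [div_div, sq]

theorem integral_inv_max_one_le (hH : 2 ≤ H) :
    ∫ x in (0 : ℝ)..(1 / 2), (max 1 (H * x))⁻¹ ≤ 2 * (Real.log (2 * H) / H) := by
  have hH0 : 0 < H := by linarith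
  have h := integral_inv_max_one_mul_cos_eq hH 0
  simp only [zero_mul, Real.cos_zero, mul_one, intervalIntegral.integral_const, mul_inv,
    intervalIntegral.integral_const_mul] at h
  rw [integral_inv_of_pos (by positivity) (by norm_num)] at h
  rw [h]
  have hlog : Real.log (1 / 2 / H⁻¹) ≤ Real.log (2 * H) := by
    apply Real.log_le_log (by positivity)
    rw [div_inv_eq_mul]; linarith
  have hone : 1 ≤ Real.log (2 * H) := by
    rw [Real.le_log_iff_exp_le (by positivity)]
    linarith [Real.exp_one_lt_d9]
  simp only [sub_zero, smul_eq_mul, mul_one]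
  calc H⁻¹ + H⁻¹ * Real.log (1 / 2 / H⁻¹)
      ≤ H⁻¹ * Real.log (2 * H) + H⁻¹ * Real.log (2 * H) := by
        have hi : 0 ≤ H⁻¹ := by positivity
        nlinarith
    _ = 2 * (Real.log (2 * H) / H) := by ring

theorem abs_integral_inv_max_one_mul_cos_le_log (hH : 2 ≤ H) (w : ℝ) :
    |∫ x in (0 : ℝ)..(1 / 2), (max 1 (H * x))⁻¹ * Real.cos (w * x)| ≤
      2 * (Real.log (2 * H) / H) := by
  refine le_trans ?_ (integral_inv_max_one_le hH)
  rw [← Real.norm_eq_abs]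
  apply intervalIntegral.norm_integral_le_of_norm_le (by norm_num)
  · refine Filter.Eventually.of_forall fun x _ => ?_
    have hp : 0 ≤ (max 1 (H * x))⁻¹ := inv_nonneg.2 (le_trans zero_le_one (le_max_left _ _))
    rw [norm_mul, Real.norm_of_nonneg hp]
    exact mul_le_of_le_one_right hp (Real.abs_cos_le_one _)
  · exact (continuous_inv_max_one H).intervalIntegrable _ _

end Tail

/-- The function `min(1, 1/(H‖θ‖))`, written as `1 / max(1, H‖θ‖)`, on the circle. -/
noncomputable def circleMin (H : ℝ) : C(UnitAddCircle, ℂ) where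
  toFun x := ((max 1 (H * ‖x‖))⁻¹ : ℝ)
  continuous_toFun := Complex.continuous_ofReal.comp
    (Continuous.inv₀ (by fun_prop) fun _ => (lt_of_lt_of_le one_pos (le_max_left _ _)).ne')

theorem mfun_eq_inv_max {H : ℝ} (hH : 0 < H) (θ : ℝ) :
    mfun H θ = (max 1 (H * ‖(θ : UnitAddCircle)‖))⁻¹ := by
  rw [UnitAddCircle.norm_eq, mfun]
  split_ifs with h
  · simp [h]
  · have hpos : 0 < H * |θ - round θ| :=
      mul_pos hH (lt_of_le_of_ne (abs_nonneg _) (Ne.symm h))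
    rcases le_total 1 (H * |θ - round θ|) with h1 | h1
    · rw [max_eq_right h1, min_eq_right, one_div]
      rw [one_div]; exact inv_le_one_of_one_le₀ h1
    · rw [max_eq_left h1, min_eq_left, inv_one]
      rw [one_div]; exact (one_le_inv₀ hpos).2 h1

theorem fourier_one_eq_eC (n : ℤ) (x : ℝ) : fourier n (x : UnitAddCircle) = eC (n * x) := by
  rw [fourier_coe_apply, eC]
  congr 1
  push_cast
  ring

theorem eC_add_eC_neg (x : ℝ) : eC (-x) + eC x = ((2 * Real.cos (2 * Real.pi * x) : ℝ) : ℂ) := by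
  simp only [eC, Complex.exp_mul_I, ← Complex.ofReal_cos, ← Complex.ofReal_sin, mul_neg,
    Real.cos_neg, Real.sin_neg]
  push_cast
  ring

theorem norm_coe_unitAddCircle_of_mem {x : ℝ} (hx : x ∈ Set.uIcc (0 : ℝ) (1 / 2)) :
    ‖(x : UnitAddCircle)‖ = x := by
  rw [Set.uIcc_of_le (by norm_num)] at hx
  rw [(AddCircle.norm_coe_eq_abs_iff 1 one_ne_zero).2, abs_of_nonneg hx.1]
  rw [abs_of_nonneg hx.1]; simpa using hx.2

theorem fourierCoeff_circleMin (H : ℝ) (n : ℤ) :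
    fourierCoeff (circleMin H) n =
      ((2 * ∫ x in (0 : ℝ)..(1 / 2), (max 1 (H * x))⁻¹ * Real.cos (2 * Real.pi * n * x) : ℝ) :
        ℂ) := by
  set φ : ℝ → ℂ := fun x => fourier (-n) (x : UnitAddCircle) • circleMin H (x : UnitAddCircle)
    with hφ
  have hc : Continuous φ :=
    ((fourier (-n)).continuous.comp (AddCircle.continuous_mk' (1 : ℝ))).smul
      ((circleMin H).continuous.comp (AddCircle.continuous_mk' (1 : ℝ)))
  have hneg : ∫ x in (-(1 / 2) : ℝ)..0, φ x = ∫ x in (0 : ℝ)..(1 / 2), φ (-x) := by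
    rw [intervalIntegral.integral_comp_neg, neg_zero]
  rw [fourierCoeff_eq_intervalIntegral _ n (-(1 / 2)), show -(1 / 2) + (1 : ℝ) = 1 / 2 by norm_num,
    ← intervalIntegral.integral_add_adjacent_intervals (hc.intervalIntegrable _ 0)
      (hc.intervalIntegrable 0 _), hneg,
    ← intervalIntegral.integral_add (f := fun x => φ (-x)) ((hc.comp continuous_neg).intervalIntegrable _ _)
      (hc.intervalIntegrable _ _), ← intervalIntegral.integral_const_mul,
    ← intervalIntegral.integral_ofReal, div_one, one_smul]
  refine intervalIntegral.integral_congr fun x hx => ?_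
  have h1 : circleMin H ((-x : ℝ) : UnitAddCircle) = ((max 1 (H * x))⁻¹ : ℝ) := by
    change ((_ : ℝ) : ℂ) = _
    rw [AddCircle.coe_neg, norm_neg, norm_coe_unitAddCircle_of_mem hx]
  have h2 : circleMin H (x : UnitAddCircle) = ((max 1 (H * x))⁻¹ : ℝ) := by
    change ((_ : ℝ) : ℂ) = _
    rw [norm_coe_unitAddCircle_of_mem hx]
  have h3 := eC_add_eC_neg (n * x)
  simp only [hφ, h1, h2, fourier_one_eq_eC, smul_eq_mul]
  rw [← add_mul, Int.cast_neg, neg_mul_neg, neg_mul, add_comm (eC _), h3, ← Complex.ofReal_mul]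
  congr 1
  rw [mul_assoc (2 * Real.pi)]
  ring

theorem norm_fourierCoeff_circleMin_le {H : ℝ} (hH : 2 ≤ H) (n : ℤ) :
    ‖fourierCoeff (circleMin H) n‖ ≤ 4 * (Real.log (2 * H) / H) := by
  rw [fourierCoeff_circleMin, Complex.norm_real, Real.norm_eq_abs, abs_mul, abs_two]
  linarith [abs_integral_inv_max_one_mul_cos_le_log hH (2 * Real.pi * n)]

theorem norm_fourierCoeff_circleMin_le_inv {H : ℝ} (hH : 2 ≤ H) {n : ℤ} (hn : n ≠ 0) :
    ‖fourierCoeff (circleMin H) n‖ ≤ 1 / |(n : ℝ)| := by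
  have hn' : (n : ℝ) ≠ 0 := Int.cast_ne_zero.2 hn
  rw [fourierCoeff_circleMin, Complex.norm_real, Real.norm_eq_abs, abs_mul, abs_two]
  have h := abs_integral_inv_max_one_mul_cos_le hH (w := 2 * Real.pi * n) (by positivity)
  calc _ ≤ 2 * (3 / |2 * Real.pi * n|) := by linarith
    _ = 3 / Real.pi * (1 / |(n : ℝ)|) := by
      rw [abs_mul, abs_of_pos (by positivity : 0 < 2 * Real.pi)]
      field_simp
    _ ≤ 1 * (1 / |(n : ℝ)|) := by
      gcongr
      rw [div_le_one Real.pi_pos]; exact Real.pi_gt_three.le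
    _ = _ := one_mul _

theorem norm_fourierCoeff_circleMin_le_sq {H : ℝ} (hH : 2 ≤ H) {n : ℤ} (hn : n ≠ 0) :
    ‖fourierCoeff (circleMin H) n‖ ≤ H / (n : ℝ) ^ 2 := by
  have hn' : (n : ℝ) ≠ 0 := Int.cast_ne_zero.2 hn
  rw [fourierCoeff_circleMin, Complex.norm_real, Real.norm_eq_abs, abs_mul, abs_two]
  have hs : Real.sin (2 * Real.pi * n * (1 / 2)) = 0 := by
    rw [show 2 * Real.pi * n * (1 / 2) = n * Real.pi by ring, Real.sin_int_mul_pi]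
  have h := abs_integral_inv_max_one_mul_cos_le_sq hH (w := 2 * Real.pi * n) (by positivity) hs
  calc _ ≤ 2 * (2 * H / (2 * Real.pi * n) ^ 2) := by linarith
    _ = 1 / Real.pi ^ 2 * (H / (n : ℝ) ^ 2) := by field_simp
    _ ≤ 1 * (H / (n : ℝ) ^ 2) := by
      gcongr
      rw [div_le_one (by positivity)]
      nlinarith [Real.pi_gt_three]
    _ = _ := one_mul _

theorem summable_fourierCoeff_circleMin {H : ℝ} (hH : 2 ≤ H) :
    Summable (fourierCoeff (circleMin H)) := by
  have hs : Summable fun n : ℤ => H * (1 / (n : ℝ) ^ 2) :=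
    (Real.summable_one_div_int_pow.2 one_lt_two).mul_left H
  refine Summable.of_norm_bounded_eventually hs ?_
  filter_upwards [(Set.finite_singleton (0 : ℤ)).compl_mem_cofinite] with n hn
  rw [mul_one_div]
  exact norm_fourierCoeff_circleMin_le_sq hH hn

theorem hasSum_mfun {H : ℝ} (hH : 2 ≤ H) (θ : ℝ) :
    HasSum (fun n : ℤ => fourierCoeff (circleMin H) n * eC (n * θ)) (mfun H θ : ℂ) := by
  have h := has_pointwise_sum_fourier_series_of_summable (summable_fourierCoeff_circleMin hH) θ
  simp only [fourier_one_eq_eC, smul_eq_mul] at h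
  rwa [mfun_eq_inv_max (by linarith) θ]

theorem mfun_eq_one {H : ℝ} (h1 : 1 ≤ H) (h2 : H ≤ 2) (θ : ℝ) : mfun H θ = 1 := by
  rw [mfun_eq_inv_max (by linarith), UnitAddCircle.norm_eq, max_eq_left, inv_one]
  nlinarith [abs_sub_round θ, abs_nonneg (θ - round θ)]

theorem stmt_9 :
    ∃ C > 0, ∀ H : ℝ, 1 ≤ H → ∃ a : ℤ → ℂ,
      (∀ θ : ℝ, Summable (fun h : ℤ => a h * eC ((h : ℝ) * θ)) ∧
        ((mfun H θ : ℝ) : ℂ) = ∑' h : ℤ, a h * eC ((h : ℝ) * θ)) ∧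
      ‖a 0‖ ≤ C * (Real.log (2 * H) / H) ∧
      (∀ h : ℤ, h ≠ 0 →
        ‖a h‖ ≤ C * min (Real.log (2 * H) / H)
          (min (1 / |(h : ℝ)|) (H / (h : ℝ) ^ 2))) := by
  refine ⟨4, by norm_num, fun H hH => ?_⟩
  rcases le_total H 2 with h2 | h2
  · have hlog : Real.log 2 ≤ Real.log (2 * H) := Real.log_le_log (by norm_num) (by linarith)
    have hlog2 := Real.log_two_gt_d9
    refine ⟨Pi.single 0 1, fun θ => ?_, ?_, fun h hh => ?_⟩
    · have hs : HasSum (fun h : ℤ => (Pi.single 0 1 : ℤ → ℂ) h * eC ((h : ℝ) * θ))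
          ((mfun H θ : ℝ) : ℂ) := by
        convert hasSum_single (0 : ℤ) fun h hh => ?_ using 1
        · simp [mfun_eq_one hH h2, eC]
        · simp [hh]
      exact ⟨hs.summable, hs.tsum_eq.symm⟩
    · rw [Pi.single_eq_same, norm_one, ← mul_div_assoc, le_div_iff₀ (by linarith)]
      linarith
    · rw [Pi.single_eq_of_ne hh, norm_zero]
      have : 0 ≤ Real.log (2 * H) := by linarith
      positivity
  · refine ⟨fourierCoeff (circleMin H),
      fun θ => ⟨(hasSum_mfun h2 θ).summable, (hasSum_mfun h2 θ).tsum_eq.symm⟩,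
      norm_fourierCoeff_circleMin_le h2 0, fun h hh => ?_⟩
    have hi := norm_fourierCoeff_circleMin_le_inv h2 hh
    have hq := norm_fourierCoeff_circleMin_le_sq h2 hh
    have hl := norm_fourierCoeff_circleMin_le h2 h
    have : 0 ≤ ‖fourierCoeff (circleMin H) h‖ := norm_nonneg _
    rw [← div_le_iff₀' (by norm_num)]
    refine le_min ?_ (le_min ?_ ?_) <;> linarith
end
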